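/- Let f : ℝ → ℝ be given by f(x) = sin(√|x|). Then there is no error bifunction e : ℝ × ℝ → ℝ ∪ {+∞} with ℝ × ℝ ⊆ dom e for which f is e-quasiconvex. -/

import Mathlib

/- Setting: real-valued functions on ℝ. Since the error bifunctions considered
here satisfy `ℝ × ℝ ⊆ dom e`, they are modeled as real-valued maps
`e : ℝ → ℝ → ℝ` that are nonnegative and symmetric. -/

noncomputable section

/-- `e` is a (finite-valued) error bifunction: nonnegative and symmetric. -/
def IsErrorBifunR (e : ℝ → ℝ → ℝ) : Prop :=
  (∀ x y, 0 ≤ e x y) ∧ (∀ x y, e x y = e y x)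

/-- `f : ℝ → ℝ` is `e`-convex. -/
def EConvexR (e : ℝ → ℝ → ℝ) (f : ℝ → ℝ) : Prop :=
  ∀ x y : ℝ, ∀ t ∈ Set.Ioo (0:ℝ) 1,
    f (t * x + (1 - t) * y) ≤ t * f x + (1 - t) * f y + t * (1 - t) * e x y

/-- `f : ℝ → ℝ` is `e`-quasiconvex. -/
def EQuasiconvexR (e : ℝ → ℝ → ℝ) (f : ℝ → ℝ) : Prop :=
  ∀ x y : ℝ, ∀ t ∈ Set.Ioo (0:ℝ) 1,
    f (t * x + (1 - t) * y) ≤ max (f x) (f y) + t * (1 - t) * e x y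

/-- `f(x) = sin(√|x|)` is not `e`-quasiconvex for any error
bifunction `e` with `ℝ × ℝ ⊆ dom e`. -/
theorem stmt19 :
    ¬ ∃ e : ℝ → ℝ → ℝ, IsErrorBifunR e ∧
      EQuasiconvexR e (fun x => Real.sin (Real.sqrt |x|)) := by
  rintro ⟨e, ⟨hnonneg, -⟩, hq⟩
  have hC : 0 ≤ e (Real.pi ^ 2) 0 := hnonneg _ _
  set C := e (Real.pi ^ 2) 0 with hCdef
  have hpi := Real.pi_pos
  obtain ⟨s, hs, hs_half, hsC⟩ : ∃ s : ℝ, 0 < s ∧ s ≤ 1 / 2 ∧ s * C < 2 := by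
    refine ⟨1 / (C + 2), by positivity, ?_, ?_⟩
    · exact one_div_le_one_div_of_le two_pos (by linarith)
    · rw [one_div_mul_eq_div, div_lt_iff₀ (by positivity)]
      linarith
  have h := hq (Real.pi ^ 2) 0 (s ^ 2) ⟨by positivity, by nlinarith⟩
  have hsqrt : Real.sqrt |s ^ 2 * Real.pi ^ 2| = Real.pi * s := by
    rw [← mul_pow, abs_of_nonneg (by positivity), Real.sqrt_sq (by positivity), mul_comm]
  have hsqrt_pi : Real.sqrt |Real.pi ^ 2| = Real.pi := by
    rw [abs_of_nonneg (by positivity), Real.sqrt_sq hpi.le]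
  simp only [mul_zero, add_zero, hsqrt, hsqrt_pi, Real.sin_pi, abs_zero, Real.sqrt_zero,
    Real.sin_zero, max_self, zero_add, ← hCdef] at h
  have hsin : 2 / Real.pi * (Real.pi * s) ≤ Real.sin (Real.pi * s) :=
    Real.mul_le_sin (by positivity) (by nlinarith)
  rw [← mul_assoc, div_mul_cancel₀ _ hpi.ne'] at hsin
  have hbound : s ^ 2 * (1 - s ^ 2) * C ≤ s * (s * C) := by
    nlinarith [mul_nonneg (sq_nonneg (s ^ 2)) hC]
  nlinarith [mul_lt_mul_of_pos_left hsC hs]
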